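/- arXiv:1311.5799 — 6 statements merged into one kernel-verified Lean document; each statement's English description precedes it below -/
import Mathlib

section
/- Let A = (A,δ,a₀,τ) be an accessible crisp-deterministic fuzzy automaton over a complete residuated lattice L, and let A_N̄ be its reverse Nerode automaton. Then distinct states of A_N̄ have distinct right fuzzy languages: if g, h ∈ {τ_u | u ∈ X*} with g ≠ h (as functions A → L), then the right fuzzy language of g in A_N̄ differs from the right fuzzy language of h in A_N̄, where the right fuzzy language of a state g of A_N̄ is the fuzzy language v ↦ τ_N̄(δ_N̄*(g,v)). -/
/-- A complete residuated lattice: a complete lattice with least element `⊥` (the `0` of the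
paper) and greatest element `⊤`, together with a commutative monoid operation `*` (the
multiplication `⊗`) whose unit `1` is the greatest element, and a residuum `resid` satisfying
the adjunction property. -/
class CompleteResiduatedLattice (L : Type*) extends CompleteLattice L, CommMonoid L where
  one_eq_top : (1 : L) = ⊤
  resid : L → L → L
  adjunction : ∀ x y z : L, x * y ≤ z ↔ x ≤ resid y z


/-- Let `(A, δ, a₀, τ)` be an accessible crisp-deterministic fuzzy
automaton over a complete residuated lattice `L`, and let `A_N̄` be its reverse Nerode
automaton: states are the functions `τ_u : a ↦ τ(δ*(a,u))` for `u ∈ X*`, the transition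
by a letter `x` sends `g` to `a ↦ g(δ(a,x))` (so `δ_N̄(τ_u,x) = τ_{xu}`), and the terminal
value of a state `g` is `g(a₀)`.  Then distinct states of `A_N̄` have distinct right fuzzy
languages `v ↦ τ_N̄(δ_N̄*(g,v))`. -/
theorem reverse_Nerode_distinct_right_languages {L X A : Type*}
    [CompleteResiduatedLattice L] [Fintype X] [Nonempty X]
    (δ : A → X → A) (a₀ : A) (τ : A → L)
    (hacc : ∀ a : A, ∃ u : List X, u.foldl δ a₀ = a)
    (g h : A → L)
    (hg : ∃ u : List X, g = fun a => τ (u.foldl δ a))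
    (hh : ∃ u : List X, h = fun a => τ (u.foldl δ a))
    (hne : g ≠ h) :
    (fun v : List X =>
        (v.foldl (fun (k : A → L) (x : X) => fun a => k (δ a x)) g) a₀)
      ≠ fun v : List X =>
        (v.foldl (fun (k : A → L) (x : X) => fun a => k (δ a x)) h) a₀ := by
  have key : ∀ (v : List X) (k : A → L) (a : A),
      (v.foldl (fun (k : A → L) (x : X) => fun a => k (δ a x)) k) a
        = k (v.reverse.foldl δ a) := by
    intro v
    induction v with
    | nil => intro k a; rfl
    | cons x v ih =>
      intro k a
      rw [List.foldl_cons, ih]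
      simp
  intro heq
  apply hne
  funext a
  obtain ⟨u, rfl⟩ := hacc a
  have h1 := congrFun heq u.reverse
  simp only [key, List.reverse_reverse] at h1
  exact h1
end

section
/- (Theorem 3.5, equivalence part) Let A = (A,δ,a₀,τ) be an accessible crisp-deterministic fuzzy automaton over a complete residuated lattice L. Then the reverse Nerode automaton A_N̄ is a well-defined crisp-deterministic fuzzy automaton recognizing the reverse of the fuzzy language of A: the transitions are well-defined (if τ_u = τ_v then τ_{xu} = τ_{xv} for every x ∈ X), and for every word u ∈ X*, [[A_N̄]](u) = [[A]](ū). -/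
/-- **Theorem 3.5, equivalence part.** Let `(A, δ, a₀, τ)` be an accessible
crisp-deterministic fuzzy automaton over a complete residuated lattice `L`.  Then the
reverse Nerode automaton `A_N̄` is a well-defined crisp-deterministic fuzzy automaton
recognizing the reverse of the fuzzy language of `A`: the transitions are well defined
(if `τ_u = τ_v` then `τ_{xu} = τ_{xv}` for every letter `x`, where
`τ_u : a ↦ τ(δ*(a,u))`), and for every word `u ∈ X*`,
`[[A_N̄]](u) = τ_N̄(δ_N̄*(τ_ε, u)) = [[A]](ū)`.  Here the transition of `A_N̄` by a letter
`x` sends a state `g` to `a ↦ g(δ(a,x))`, and the terminal value of a state `g` is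
`g(a₀)`. -/
theorem reverse_Nerode_recognizes_reverse_language {L X A : Type*}
    [CompleteResiduatedLattice L] [Fintype X] [Nonempty X]
    (δ : A → X → A) (a₀ : A) (τ : A → L)
    (hacc : ∀ a : A, ∃ u : List X, u.foldl δ a₀ = a) :
    (∀ u v : List X,
      (fun a : A => τ (u.foldl δ a)) = (fun a : A => τ (v.foldl δ a)) →
      ∀ x : X,
        (fun a : A => τ ((x :: u).foldl δ a)) = fun a : A => τ ((x :: v).foldl δ a)) ∧
    (∀ u : List X,
      (u.foldl (fun (k : A → L) (x : X) => fun a => k (δ a x))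
          (fun a : A => τ (([] : List X).foldl δ a))) a₀
        = τ (u.reverse.foldl δ a₀)) := by
  refine ⟨fun u v h x => ?_, fun u => ?_⟩
  · funext a
    exact congrFun h (δ a x)
  · have key : ∀ (w : List X) (g : A → L) (a : A),
        (w.foldl (fun (k : A → L) (x : X) => fun a => k (δ a x)) g) a
          = g (w.reverse.foldl δ a) := by
      intro w
      induction w with
      | nil => intro g a; rfl
      | cons x w ih =>
        intro g a
        rw [List.foldl_cons, ih, List.reverse_cons, List.foldl_append]
        rfl
    exact key u _ a₀
end

section
/- (Theorem 3.5, minimality part) Let A = (A,δ,a₀,τ) be an accessible crisp-deterministic fuzzy automaton over a complete residuated lattice L. Then the reverse Nerode automaton A_N̄ is a minimal crisp-deterministic fuzzy automaton recognizing the reverse of [[A]]: for every crisp-deterministic fuzzy automaton B = (B,δ',b₀,τ') over L and X with [[B]](u) = [[A]](ū) for all u ∈ X*, the cardinality of the state set A_N̄ = {τ_u | u ∈ X*} is at most the cardinality of B. -/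
/-- **Theorem 3.5, minimality part.** Let `(A, δ, a₀, τ)` be an accessible
crisp-deterministic fuzzy automaton over a complete residuated lattice `L`.  Then the
reverse Nerode automaton `A_N̄` is a minimal crisp-deterministic fuzzy automaton
recognizing the reverse of `[[A]]`: for every crisp-deterministic fuzzy automaton
`(B, δ', b₀, τ')` over `L` and `X` with `[[B]](u) = [[A]](ū)` for all words `u`, the
cardinality of the state set `A_N̄ = {τ_u | u ∈ X*}` (where `τ_u : a ↦ τ(δ*(a,u))`) is at
most the cardinality of `B` (there is an injection). -/
theorem reverse_Nerode_minimal {L X A B : Type*}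
    [CompleteResiduatedLattice L] [Fintype X] [Nonempty X]
    (δ : A → X → A) (a₀ : A) (τ : A → L)
    (hacc : ∀ a : A, ∃ u : List X, u.foldl δ a₀ = a)
    (δ' : B → X → B) (b₀ : B) (τ' : B → L)
    (heq : ∀ u : List X, τ' (u.foldl δ' b₀) = τ (u.reverse.foldl δ a₀)) :
    ∃ f : {g : A → L // ∃ u : List X, g = fun a => τ (u.foldl δ a)} → B,
      Function.Injective f := by
  have key : ∀ u v : List X,
      τ (u.foldl δ (v.foldl δ a₀)) = τ' (v.reverse.foldl δ' (u.reverse.foldl δ' b₀)) := by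
    intro u v
    rw [← List.foldl_append, ← List.foldl_append, heq]
    simp only [List.reverse_append, List.reverse_reverse]
  refine ⟨fun g => (Classical.choose g.2).reverse.foldl δ' b₀, ?_⟩
  intro g h hgh
  apply Subtype.ext
  rw [Classical.choose_spec g.2, Classical.choose_spec h.2]
  funext a
  obtain ⟨v, rfl⟩ := hacc a
  rw [key, key]
  exact congrArg (fun b => τ' (v.reverse.foldl δ' b)) hgh
end

section
/- (Theorem 3.6, minimality part) Let A = (A,δ,σ,τ) be a fuzzy automaton over a complete residuated lattice L and alphabet X. Then the Brzozowski automaton A_B = (A_N̄)_N̄ is a minimal crisp-deterministic fuzzy automaton recognizing [[A]]: for every crisp-deterministic fuzzy automaton B = (B,δ',b₀,τ') over L and X with [[B]] = [[A]], the cardinality of the state set of A_B is at most the cardinality of B. -/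
/-- Auxiliary: the extension of a fuzzy transition relation, processing the word from the
right (so that it matches the recursion `δ*(a,ux,b) = ⨆ c, δ*(a,u,c) ⊗ δ(c,x,b)` after
reversing the list). -/
def transExtAux {L A X : Type*} [CompleteResiduatedLattice L] [DecidableEq A]
    (δ : A → X → A → L) (a : A) : List X → A → L
  | [], b => if a = b then 1 else ⊥
  | x :: u, b => ⨆ c, transExtAux δ a u c * δ c x b

/-- The extension `δ* : A × X* × A → L` of a fuzzy transition relation `δ`, defined by
`δ*(a,ε,b) = 1` if `a = b` and `⊥` otherwise, and `δ*(a,ux,b) = ⨆ c, δ*(a,u,c) ⊗ δ(c,x,b)`. -/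
def transExt {L A X : Type*} [CompleteResiduatedLattice L] [DecidableEq A]
    (δ : A → X → A → L) (a : A) (u : List X) (b : A) : L :=
  transExtAux δ a u.reverse b

theorem crl_iSup_mul {L : Type*} [CompleteResiduatedLattice L] {ι : Sort*} (f : ι → L) (y : L) :
    (⨆ i, f i) * y = ⨆ i, f i * y := by
  apply le_antisymm
  · rw [CompleteResiduatedLattice.adjunction]
    refine iSup_le fun i => ?_
    rw [← CompleteResiduatedLattice.adjunction]
    exact le_iSup (fun i => f i * y) i
  · refine iSup_le fun i => ?_
    rw [CompleteResiduatedLattice.adjunction]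
    refine le_trans (le_iSup f i) ?_
    rw [← CompleteResiduatedLattice.adjunction]

theorem crl_mul_iSup {L : Type*} [CompleteResiduatedLattice L] {ι : Sort*} (f : ι → L) (y : L) :
    y * (⨆ i, f i) = ⨆ i, y * f i := by
  rw [mul_comm, crl_iSup_mul]
  simp only [mul_comm]

theorem crl_bot_mul {L : Type*} [CompleteResiduatedLattice L] (y : L) : (⊥ : L) * y = ⊥ := by
  rw [eq_bot_iff, CompleteResiduatedLattice.adjunction]
  exact bot_le

theorem transExt_act {L A X : Type*} [CompleteResiduatedLattice L] [DecidableEq A]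
    (δ : A → X → A → L) (u : List X) : ∀ h : A → L,
    (fun a => ⨆ b, transExt δ a u b * h b) =
      u.foldr (fun x h => fun a => ⨆ b, δ a x b * h b) h := by
  induction u using List.reverseRecOn with
  | nil =>
    intro h
    funext a
    simp only [transExt, List.reverse_nil, transExtAux, List.foldr_nil]
    apply le_antisymm
    · refine iSup_le fun b => ?_
      split_ifs with hab
      · rw [one_mul, hab]
      · rw [crl_bot_mul]; exact bot_le
    · refine le_trans ?_ (le_iSup _ a)
      simp
  | append_singleton u x ih =>
    intro h
    rw [List.foldr_append, List.foldr_cons, List.foldr_nil, ← ih]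
    funext a
    have e : ∀ b, transExt δ a (u ++ [x]) b = ⨆ c, transExt δ a u c * δ c x b := by
      intro b
      simp [transExt, transExtAux]
    simp only [e, crl_iSup_mul, crl_mul_iSup, mul_assoc]
    exact iSup_comm

theorem foldl_act {L A X : Type*} (D : X → (A → L) → A → L) (u : List X) :
    ∀ (k : (A → L) → L) (h : A → L),
      (u.foldl (fun (k : (A → L) → L) (x : X) => fun h => k (D x h)) k) h
        = k (u.foldr D h) := by
  induction u with
  | nil => intro k h; rfl
  | cons x u ih => intro k h; rw [List.foldl_cons, ih, List.foldr_cons]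

/-- **Theorem 3.6, minimality part.** Let `(A, δ, σ, τ)` be a fuzzy
automaton over a complete residuated lattice `L` and alphabet `X`.  The reverse Nerode
automaton `A_N̄` of `A` has state set `Q₁ = {τ_u | u ∈ X*}` where
`τ_u : a ↦ ⨆ b, δ*(a,u,b) ⊗ τ(b)`, transitions `δ_N̄(g,x) = fun a => ⨆ b, δ(a,x,b) ⊗ g(b)`
and terminal fuzzy set `τ_N̄(g) = ⨆ a, g(a) ⊗ σ(a)`.  The Brzozowski automaton
`A_B = (A_N̄)_N̄` has as its state set the right fuzzy-set family of `A_N̄`: the functions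
`Q₁ → L` of the form `q ↦ τ_N̄(δ_N̄*(q, u))`, `u ∈ X*` (written below via `List.foldl`).
Then `A_B` is a minimal crisp-deterministic fuzzy automaton recognizing `[[A]]`: for every
crisp-deterministic fuzzy automaton `(B, δ', b₀, τ')` over `L` and `X` recognizing
`[[A]]`, there is an injection of the state set of `A_B` into `B`. -/
theorem brzozowski_automaton_minimal {L A X B : Type*}
    [CompleteResiduatedLattice L] [DecidableEq A] [Nonempty A] [Fintype X] [Nonempty X]
    (δ : A → X → A → L) (σ τ : A → L)
    (δ' : B → X → B) (b₀ : B) (τ' : B → L)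
    (heq : ∀ u : List X,
      τ' (u.foldl δ' b₀) = ⨆ a, ⨆ b, σ a * transExt δ a u b * τ b) :
    ∃ f : {g : {h : A → L // ∃ u : List X, h = fun a => ⨆ b, transExt δ a u b * τ b} → L //
        ∃ u : List X,
          g = fun q =>
            (u.foldl
                (fun (k : (A → L) → L) (x : X) => fun h => k (fun a => ⨆ b, δ a x b * h b))
                (fun h => ⨆ a, h a * σ a)) q.val} → B,
      Function.Injective f := by
  have key : ∀ u v : List X,
      (u.foldl
          (fun (k : (A → L) → L) (x : X) => fun h => k (fun a => ⨆ b, δ a x b * h b))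
          (fun h => ⨆ a, h a * σ a)) (fun a => ⨆ b, transExt δ a v b * τ b)
        = τ' (v.foldl δ' (u.foldl δ' b₀)) := by
    intro u v
    rw [foldl_act (fun x h a => ⨆ b, δ a x b * h b), transExt_act, ← List.foldr_append,
      ← transExt_act, ← List.foldl_append, heq]
    refine iSup_congr fun a => ?_
    rw [crl_iSup_mul]
    refine iSup_congr fun b => ?_
    rw [mul_comm, mul_assoc]
  refine ⟨fun g => (Classical.choose g.2).foldl δ' b₀, ?_⟩
  intro g₁ g₂ hg
  apply Subtype.ext
  rw [Classical.choose_spec g₁.2, Classical.choose_spec g₂.2]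
  funext q
  obtain ⟨q, v, rfl⟩ := q
  dsimp only at hg ⊢
  rw [key, key, hg]
end

section
/- For every fuzzy automaton A = (A,δ,σ,τ) over a complete residuated lattice L, the Nerode automaton A_N is a well-defined crisp-deterministic fuzzy automaton equivalent to A: the transitions are well-defined (if σ_u = σ_v then σ_{ux} = σ_{vx} for every x ∈ X), and [[A_N]](u) = [[A]](u) for every word u ∈ X*. -/
theorem CRL_iSup_mul {L ι : Type*} [CompleteResiduatedLattice L] (f : ι → L) (y : L) :
    (⨆ i, f i) * y = ⨆ i, f i * y := by
  apply le_antisymm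
  · rw [CompleteResiduatedLattice.adjunction]
    refine iSup_le fun i => ?_
    rw [← CompleteResiduatedLattice.adjunction]
    exact le_iSup (fun i => f i * y) i
  · refine iSup_le fun i => ?_
    rw [CompleteResiduatedLattice.adjunction]
    refine (le_iSup f i).trans ?_
    rw [← CompleteResiduatedLattice.adjunction]

theorem CRL_mul_iSup {L ι : Type*} [CompleteResiduatedLattice L] (f : ι → L) (y : L) :
    y * (⨆ i, f i) = ⨆ i, y * f i := by
  rw [mul_comm, CRL_iSup_mul]
  simp only [mul_comm]

theorem nerode_step {L A X : Type*} [CompleteResiduatedLattice L] [DecidableEq A]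
    (δ : A → X → A → L) (σ : A → L) (u : List X) (x : X) :
    (fun a : A => ⨆ b, σ b * transExt δ b (u ++ [x]) a)
      = fun c : A => ⨆ b, (⨆ a, σ a * transExt δ a u b) * δ b x c := by
  funext c
  simp only [transExt, List.reverse_append, List.reverse_cons, List.reverse_nil, List.nil_append,
    List.cons_append, transExtAux, CRL_mul_iSup, CRL_iSup_mul]
  rw [iSup_comm]
  simp only [mul_assoc]

theorem nerode_foldl {L A X : Type*} [CompleteResiduatedLattice L] [DecidableEq A]
    (δ : A → X → A → L) (σ : A → L) (u : List X) :
    u.foldl (fun (g : A → L) (x : X) => fun c => ⨆ b, g b * δ b x c)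
        (fun a : A => ⨆ b, σ b * transExt δ b ([] : List X) a)
      = fun a : A => ⨆ b, σ b * transExt δ b u a := by
  induction u using List.reverseRecOn with
  | nil => rfl
  | append_singleton u x ih =>
    rw [List.foldl_append, ih, nerode_step]
    rfl

/-- For every fuzzy automaton `(A, δ, σ, τ)` over a complete residuated
lattice `L`, the Nerode automaton `A_N` is a well-defined crisp-deterministic fuzzy
automaton equivalent to `A`.  Here `σ_u : a ↦ ⨆ b, σ(b) ⊗ δ*(b,u,a)`, the transition of
`A_N` by a letter `x` sends a state `g` to `a ↦ ⨆ b, g(b) ⊗ δ(b,x,a)` (so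
`δ_N(σ_u,x) = σ_{ux}`), and the terminal value of a state `g` is `⨆ a, g(a) ⊗ τ(a)`.
The claims: transitions are well defined (if `σ_u = σ_v` then `σ_{ux} = σ_{vx}` for every
`x`), and `[[A_N]](u) = τ_N(δ_N*(σ_ε, u)) = [[A]](u)` for every word `u ∈ X*`. -/
theorem nerode_automaton_equivalent {L A X : Type*}
    [CompleteResiduatedLattice L] [DecidableEq A] [Nonempty A] [Fintype X] [Nonempty X]
    (δ : A → X → A → L) (σ τ : A → L) :
    (∀ u v : List X,
      (fun a : A => ⨆ b, σ b * transExt δ b u a)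
        = (fun a : A => ⨆ b, σ b * transExt δ b v a) →
      ∀ x : X,
        (fun a : A => ⨆ b, σ b * transExt δ b (u ++ [x]) a)
          = fun a : A => ⨆ b, σ b * transExt δ b (v ++ [x]) a) ∧
    (∀ u : List X,
      (⨆ a,
        (u.foldl (fun (g : A → L) (x : X) => fun c => ⨆ b, g b * δ b x c)
            (fun a : A => ⨆ b, σ b * transExt δ b ([] : List X) a)) a * τ a)
        = ⨆ a, ⨆ b, σ a * transExt δ a u b * τ b) := by
  refine ⟨fun u v h x => ?_, fun u => ?_⟩
  · rw [nerode_step, nerode_step]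
    funext c
    exact iSup_congr fun b => congrArg (fun t => t * δ b x c) (congrFun h b)
  · rw [nerode_foldl]
    simp only [CRL_iSup_mul]
    rw [iSup_comm]
end

section
/- For the three-state fuzzy automaton A over the Goguen structure and one-letter alphabet {x} given in the context, the set {σ_u | u ∈ X*} ⊆ [0,1]^A is infinite; consequently the Nerode automaton of A has infinitely many states. -/
noncomputable section

/-- The fuzzy transition relation (for the unique letter `x`) of the example fuzzy
automaton over the Goguen (product) structure on `[0,1] ⊆ ℝ`: states `a₀, a₁, a₂` are
`0, 1, 2 : Fin 3`, and `δ(a₀,x,a₁) = 0.5`, `δ(a₀,x,a₂) = 1`, `δ(a₁,x,a₁) = 1`,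
`δ(a₂,x,a₁) = 1`, `δ(a₂,x,a₂) = 0.5`, all other values being `0`. -/
def del : Fin 3 → Fin 3 → ℝ := ![![0, 0.5, 1], ![0, 1, 0], ![0, 1, 0.5]]

/-- The fuzzy set of initial states `σ = (1,0,0)`. -/
def sig : Fin 3 → ℝ := ![1, 0, 0]

/-- The fuzzy set of terminal states `τ = (0,1,0)`. -/
def ter : Fin 3 → ℝ := ![0, 1, 0]

/-- Auxiliary: `δ*` processing the word from the right, so that after reversing it matches
`δ*(a,ε,b) = 1` if `a = b` and `0` otherwise, `δ*(a,ux,b) = ⨆ c, δ*(a,u,c) ⬝ δ(c,x,b)`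
(the one-letter alphabet is modeled by `Unit`, `⊗` is real multiplication and `⨆` is the
supremum over the three states). -/
def dstarAux (a : Fin 3) : List Unit → Fin 3 → ℝ
  | [], b => if a = b then 1 else 0
  | _ :: u, b => ⨆ c : Fin 3, dstarAux a u c * del c b

/-- The extension `δ*` of the transition relation of the example automaton. -/
def dstar (a : Fin 3) (u : List Unit) (b : Fin 3) : ℝ := dstarAux a u.reverse b

theorem real_sup_three_eq (f : Fin 3 → ℝ) : (⨆ c, f c) = max (f 0) (max (f 1) (f 2)) := by
  apply le_antisymm
  · apply ciSup_le
    intro c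
    fin_cases c <;> simp
  · have hb : BddAbove (Set.range f) := (Set.finite_range f).bddAbove
    exact max_le (le_ciSup hb 0) (max_le (le_ciSup hb 1) (le_ciSup hb 2))

theorem dstarAux_rep (n : ℕ) :
    dstarAux 0 (List.replicate (n + 1) ()) 0 = 0 ∧
    dstarAux 0 (List.replicate (n + 1) ()) 2 = (1 / 2 : ℝ) ^ n := by
  induction n with
  | zero =>
    constructor <;> simp [dstarAux, real_sup_three_eq, del]
  | succ k ih =>
    obtain ⟨h0, h2⟩ := ih
    rw [List.replicate_succ]
    constructor
    · rw [dstarAux, real_sup_three_eq]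
      simp [del]
    · rw [dstarAux, real_sup_three_eq, h0, h2]
      have : (0 : ℝ) ≤ (1 / 2 : ℝ) ^ k * 0.5 := by positivity
      simp only [del, Matrix.cons_val, Matrix.cons_val_zero, Matrix.cons_val_one, mul_zero, zero_mul]
      rw [max_eq_right this, max_eq_right this, pow_succ]
      norm_num

/-- For the three-state example fuzzy automaton over the Goguen
structure and the one-letter alphabet `{x}`, the set `{σ_u | u ∈ X*}` (the state set of
the Nerode automaton of the automaton, where `σ_u(a) = ⨆ b, σ(b) ⊗ δ*(b,u,a)`) is
infinite; hence the Nerode automaton has infinitely many states. -/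
theorem example_nerode_infinite :
    {g : Fin 3 → ℝ |
      ∃ u : List Unit, g = fun a : Fin 3 => ⨆ b : Fin 3, sig b * dstar b u a}.Infinite := by
  refine Set.infinite_of_injective_forall_mem
    (f := fun n : ℕ => fun a : Fin 3 =>
      ⨆ b : Fin 3, sig b * dstar b (List.replicate (n + 1) ()) a) ?_ ?_
  · intro m n h
    have h2 := congrFun h 2
    have key : ∀ k : ℕ, (⨆ b : Fin 3, sig b * dstar b (List.replicate (k + 1) ()) 2)
        = (1 / 2 : ℝ) ^ k := by
      intro k
      rw [real_sup_three_eq]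
      have hp : (0 : ℝ) ≤ (1 / 2 : ℝ) ^ k := by positivity
      simp only [sig, dstar, List.reverse_replicate, (dstarAux_rep k).2, Matrix.cons_val,
        Matrix.cons_val_zero, Matrix.cons_val_one, one_mul, zero_mul, max_self]
      exact max_eq_left hp
    simp only [key] at h2
    exact pow_right_injective₀ (by norm_num) (by norm_num) h2
  · intro n
    exact ⟨_, rfl⟩

end
end
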